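/- arXiv:2402.02434 — 4 statements merged into one kernel-verified Lean document; each statement's English description precedes it below -/
import Mathlib

section
/- Let 0 < η ≤ 1 and r ∈ (0,1). Let (F_k)_{k≥0} and (G_k)_{k≥0} be Schur chains whose Szegő constants satisfy η(F) ≥ η and η(G) ≥ η. Then for every n ∈ ℕ one has ‖F_n − G_n‖_{L²(r𝕋)} ≤ C(η,r) · r^{−n} · ‖F_0 − G_0‖_{L²(r𝕋)}. -/
open Complex Metric Finset Filter

noncomputable section

/-- A Schur chain: each `F k` is analytic on the open unit disc, bounded by `1` there,
`‖F k 0‖ < 1`, and the Schur algorithm recursion holds. -/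
def IsSchurChain (F : ℕ → ℂ → ℂ) : Prop :=
  ∀ k : ℕ,
    DifferentiableOn ℂ (F k) (Metric.ball 0 1) ∧
    (∀ z ∈ Metric.ball (0 : ℂ) 1, ‖F k z‖ ≤ 1) ∧
    ‖F k 0‖ < 1 ∧
    ∀ z ∈ Metric.ball (0 : ℂ) 1,
      z * F (k + 1) z * (1 - (starRingEnd ℂ) (F k 0) * F k z) = F k z - F k 0

/-- The Szegő constant of a Schur chain: the limit (equivalently the infimum, since the
partial products are nonincreasing and lie in `[0,1]`) of `∏_{k<N} (1 - ‖F k 0‖²)`. -/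
def szego (F : ℕ → ℂ → ℂ) : ℝ :=
  ⨅ N : ℕ, ∏ k ∈ Finset.range N, (1 - ‖F k 0‖ ^ 2)

/-- The constant `C(η, r)`. -/
def Cconst (η r : ℝ) : ℝ :=
  Real.exp (Real.log (1 / η) * (2 + 1 / (1 - Real.sqrt (1 - η))) * (4 / (1 - r) ^ 2 + 1))

/-- `‖H‖_{L²(r𝕋)}`, the `L²` norm of `H` on the circle of radius `r`,
with respect to the normalized Lebesgue measure on the circle. -/
def L2rT (H : ℂ → ℂ) (r : ℝ) : ℝ :=
  Real.sqrt ((2 * Real.pi)⁻¹ *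
    ∫ θ in (0:ℝ)..(2 * Real.pi), ‖H (r * Complex.exp (θ * Complex.I))‖ ^ 2)


lemma pseudo (a w : ℂ) (ha : ‖a‖ ≤ 1) (hw : ‖w‖ ≤ 1) :
    ‖a + w‖ ≤ (‖a‖ + ‖w‖) * ‖1 + (starRingEnd ℂ) a * w‖ := by
  have h1 : ‖a + w‖ ^ 2 = ‖a‖ ^ 2 + ‖w‖ ^ 2 + 2 * (a.re * w.re + a.im * w.im) := by
    simp only [Complex.sq_norm, Complex.normSq_apply]; simp; ring
  have h2 : ‖1 + (starRingEnd ℂ) a * w‖ ^ 2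
      = 1 + ‖a‖ ^ 2 * ‖w‖ ^ 2 + 2 * (a.re * w.re + a.im * w.im) := by
    simp only [Complex.sq_norm, Complex.normSq_apply]; simp; ring
  have h3 : a.re * w.re + a.im * w.im ≤ ‖a‖ * ‖w‖ := by
    have := Complex.abs_re_le_norm ((starRingEnd ℂ) a * w)
    simp at this
    linarith [le_abs_self (a.re * w.re + a.im * w.im)]
  have hA := norm_nonneg a
  have hW := norm_nonneg w
  have hR := norm_nonneg (1 + (starRingEnd ℂ) a * w)
  have hR2 := sq_nonneg (‖1 + (starRingEnd ℂ) a * w‖)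
  refine le_of_sq_le_sq ?_ (by positivity)
  rw [mul_pow]
  generalize ‖a + w‖ = u at *
  generalize ‖1 + (starRingEnd ℂ) a * w‖ = v at *
  generalize a.re * w.re + a.im * w.im = x at *
  generalize ‖a‖ = A at *
  generalize ‖w‖ = W at *
  by_cases h : 1 ≤ A + W
  · have : u ^ 2 ≤ v ^ 2 := by
      rw [h1, h2]; nlinarith [mul_nonneg (by nlinarith : 0 ≤ 1 - A ^ 2) (by nlinarith : 0 ≤ 1 - W ^ 2)]
    exact this.trans (le_mul_of_one_le_left hR2 (one_le_pow₀ h))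
  · push Not at h
    rw [h1, h2]
    have e1 : 0 ≤ (1 - (A + W) ^ 2) * (A * W - x) := mul_nonneg (by nlinarith) (by linarith)
    have e2 : 0 ≤ (A + W) ^ 2 * ((1 + A * W) ^ 2 - 1) :=
      mul_nonneg (by positivity) (by nlinarith [mul_nonneg hA hW])
    nlinarith

lemma invb (A f s φ : ℝ) (hA : 0 ≤ A) (hA' : A ≤ φ) (_hf : 0 ≤ f) (hfφ : f ≤ φ) (hf1 : f ≤ 1)
    (hs : A ≤ s) (hs1 : s < 1) : 1 ≤ (1 - A * f) * Real.exp (φ ^ 2 / (1 - s)) := by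
  have h1 : A * f ≤ s := by nlinarith
  have h2 : A * f ≤ φ ^ 2 := by nlinarith
  have h3 : (1 - A * f) * (1 + φ ^ 2 / (1 - s)) ≤ (1 - A * f) * Real.exp (φ ^ 2 / (1 - s)) := by
    apply mul_le_mul_of_nonneg_left _ (by linarith)
    linarith [Real.add_one_le_exp (φ ^ 2 / (1 - s))]
  have h4 : (φ ^ 2 / (1 - s)) * (1 - s) = φ ^ 2 := div_mul_cancel₀ _ (by linarith)
  have h5 : 0 ≤ φ ^ 2 / (1 - s) := div_nonneg (by positivity) (by linarith)
  nlinarith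

lemma stepPt (z F G a b F1 G1 : ℂ) (s f g : ℝ)
    (hF : z * F1 * (1 - (starRingEnd ℂ) a * F) = F - a)
    (hG : z * G1 * (1 - (starRingEnd ℂ) b * G) = G - b)
    (hFf : ‖F‖ ≤ f) (hGg : ‖G‖ ≤ g) (haf : ‖a‖ ≤ f) (hbg : ‖b‖ ≤ g)
    (hF1 : ‖F‖ ≤ 1) (hG1 : ‖G‖ ≤ 1) (has : ‖a‖ ≤ s) (hbs : ‖b‖ ≤ s) (hs : s < 1) :
    ‖z‖ ^ 2 * ‖F1 - G1‖ ^ 2 ≤ Real.exp ((f ^ 2 + g ^ 2) / (1 - s)) ^ 2 *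
      ((1 + f ^ 2 + (2 * f * g + f ^ 2)) *
        (‖F - G - (a - b)‖ ^ 2 + f ^ 2 * ‖F - G‖ ^ 2 + (2 * f * g + f ^ 2) * ‖a - b‖ ^ 2)) := by
  have hf0 : 0 ≤ f := (norm_nonneg _).trans hFf
  have hg0 : 0 ≤ g := (norm_nonneg _).trans hGg
  have key : z * (F1 - G1) * ((1 - (starRingEnd ℂ) a * F) * (1 - (starRingEnd ℂ) b * G)) =
      (F - G - (a - b)) + ((starRingEnd ℂ) (a - b) * (F * G) - a * (starRingEnd ℂ) a * (F - G)
       - a * (starRingEnd ℂ) (a - b) * G + (starRingEnd ℂ) a * (a - b) * F) := by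
    simp only [map_sub]
    linear_combination (1 - (starRingEnd ℂ) b * G) * hF - (1 - (starRingEnd ℂ) a * F) * hG
  have d1 : 1 - ‖a‖ * ‖F‖ ≤ ‖1 - (starRingEnd ℂ) a * F‖ := by
    have := norm_sub_norm_le 1 ((starRingEnd ℂ) a * F)
    simpa using this
  have d2 : 1 - ‖b‖ * ‖G‖ ≤ ‖1 - (starRingEnd ℂ) b * G‖ := by
    have := norm_sub_norm_le 1 ((starRingEnd ℂ) b * G)
    simpa using this
  have i1 := invb ‖a‖ ‖F‖ s f (norm_nonneg _) haf (norm_nonneg _) hFf hF1 has hs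
  have i2 := invb ‖b‖ ‖G‖ s g (norm_nonneg _) hbg (norm_nonneg _) hGg hG1 hbs hs
  have i1' : 1 ≤ ‖1 - (starRingEnd ℂ) a * F‖ * Real.exp (f ^ 2 / (1 - s)) :=
    i1.trans (mul_le_mul_of_nonneg_right d1 (Real.exp_pos _).le)
  have i2' : 1 ≤ ‖1 - (starRingEnd ℂ) b * G‖ * Real.exp (g ^ 2 / (1 - s)) :=
    i2.trans (mul_le_mul_of_nonneg_right d2 (Real.exp_pos _).le)
  have i3 := one_le_mul_of_one_le_of_one_le i1' i2'
  have hk := congrArg norm key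
  rw [norm_mul, norm_mul, norm_mul] at hk
  have hub : ‖z‖ * ‖F1 - G1‖ * (‖1 - (starRingEnd ℂ) a * F‖ * ‖1 - (starRingEnd ℂ) b * G‖) ≤
      ‖F - G - (a - b)‖ + f ^ 2 * ‖F - G‖ + (2 * f * g + f ^ 2) * ‖a - b‖ := by
    rw [hk]
    refine (norm_add_le _ _).trans ?_
    have t1 : ‖(starRingEnd ℂ) (a - b) * (F * G)‖ ≤ f * g * ‖a - b‖ := by
      rw [norm_mul, norm_mul, RCLike.norm_conj, mul_comm]; gcongr
    have t2 : ‖a * (starRingEnd ℂ) a * (F - G)‖ ≤ f ^ 2 * ‖F - G‖ := by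
      rw [norm_mul, norm_mul, RCLike.norm_conj, sq]; gcongr
    have t3 : ‖a * (starRingEnd ℂ) (a - b) * G‖ ≤ f * g * ‖a - b‖ := by
      rw [norm_mul, norm_mul, RCLike.norm_conj, mul_right_comm]; gcongr
    have t4 : ‖(starRingEnd ℂ) a * (a - b) * F‖ ≤ f ^ 2 * ‖a - b‖ := by
      rw [norm_mul, norm_mul, RCLike.norm_conj, mul_right_comm, sq]; gcongr
    have t5 := norm_add_le ((starRingEnd ℂ) (a - b) * (F * G) - a * (starRingEnd ℂ) a * (F - G)
       - a * (starRingEnd ℂ) (a - b) * G) ((starRingEnd ℂ) a * (a - b) * F)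
    have t6 := norm_sub_le ((starRingEnd ℂ) (a - b) * (F * G) - a * (starRingEnd ℂ) a * (F - G))
       (a * (starRingEnd ℂ) (a - b) * G)
    have t7 := norm_sub_le ((starRingEnd ℂ) (a - b) * (F * G)) (a * (starRingEnd ℂ) a * (F - G))
    linarith
  have hlin : ‖z‖ * ‖F1 - G1‖ ≤ Real.exp ((f ^ 2 + g ^ 2) / (1 - s)) *
      (‖F - G - (a - b)‖ + f ^ 2 * ‖F - G‖ + (2 * f * g + f ^ 2) * ‖a - b‖) := by
    rw [add_div, Real.exp_add]
    calc ‖z‖ * ‖F1 - G1‖ ≤ ‖z‖ * ‖F1 - G1‖ * _ := le_mul_of_one_le_right (by positivity) i3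
      _ = Real.exp (f ^ 2 / (1 - s)) * Real.exp (g ^ 2 / (1 - s)) * (‖z‖ * ‖F1 - G1‖ * (‖1 - (starRingEnd ℂ) a * F‖ * ‖1 - (starRingEnd ℂ) b * G‖)) := by ring
      _ ≤ _ := by gcongr
  rw [← mul_pow]
  refine (pow_le_pow_left₀ (by positivity) hlin 2).trans ?_
  rw [mul_pow]
  refine mul_le_mul_of_nonneg_left ?_ (by positivity)
  have hc : 0 ≤ 2 * f * g + f ^ 2 := by positivity
  have hq : 0 ≤ f ^ 2 := by positivity
  generalize 2 * f * g + f ^ 2 = c at *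
  generalize f ^ 2 = q at *
  generalize ‖F - G - (a - b)‖ = x
  generalize ‖F - G‖ = y
  generalize ‖a - b‖ = w
  nlinarith [mul_nonneg hq (sq_nonneg (x - y)), mul_nonneg hc (sq_nonneg (x - w)), mul_nonneg (mul_nonneg hq hc) (sq_nonneg (y - w))]

/-- sequences -/
lemma sumsq (r L : ℝ) (hr0 : 0 < r) (hr1 : r < 1) (A f : ℕ → ℝ) (_hA : ∀ k, 0 ≤ A k)
    (hf0 : ∀ k, 0 ≤ f k) (hf1 : ∀ k, f k ≤ 1) (hrec : ∀ k, f k ≤ A k + r * f (k + 1))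
    (hL : ∀ N, ∑ k ∈ range N, A k ^ 2 ≤ L) (n : ℕ) :
    ∑ k ∈ range n, f k ^ 2 ≤ L / (1 - r) ^ 2 := by
  have h1r : 0 < 1 - r := by linarith
  have hsq : ∀ k, (1 - r) * f k ^ 2 ≤ A k ^ 2 + (1 - r) * r * f (k + 1) ^ 2 := by
    intro k
    have : f k ^ 2 ≤ (A k + r * f (k + 1)) ^ 2 := pow_le_pow_left₀ (hf0 k) (hrec k) 2
    nlinarith [mul_nonneg hr0.le (sq_nonneg (A k - (1 - r) * f (k + 1)))]
  have hS : ∀ N, (1 - r) ^ 2 * ∑ k ∈ range N, f k ^ 2 ≤ L + f N ^ 2 := by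
    intro N
    have e1 : (1 - r) * ∑ k ∈ range N, f k ^ 2 ≤
        ∑ k ∈ range N, A k ^ 2 + (1 - r) * r * ∑ k ∈ range N, f (k + 1) ^ 2 := by
      rw [mul_sum, mul_sum, ← sum_add_distrib]
      exact sum_le_sum fun k _ => hsq k
    have e2 : ∑ k ∈ range N, f (k + 1) ^ 2 + f 0 ^ 2 = ∑ k ∈ range N, f k ^ 2 + f N ^ 2 := by
      rw [← sum_range_succ' (fun k => f k ^ 2), ← sum_range_succ]
    have e3 := hL N
    have e4 : (1 - r) * r ≤ 1 := by nlinarith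
    have e5 : 0 ≤ (1 - r) * r := by positivity
    nlinarith [mul_nonneg e5 (sq_nonneg (f 0)), mul_nonneg (sub_nonneg.2 e4) (sq_nonneg (f N))]
  have hsum : Summable fun k => f k ^ 2 := by
    refine summable_of_sum_range_le (c := (L + 1) / (1 - r) ^ 2) (fun k => sq_nonneg _) fun N => ?_
    rw [le_div_iff₀ (by positivity)]
    nlinarith [hS N, hf0 N, hf1 N]
  have ht := hsum.tendsto_atTop_zero
  have h2 : ∑' k, f k ^ 2 ≤ L / (1 - r) ^ 2 := by
    rw [le_div_iff₀ (by positivity), mul_comm]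
    refine le_of_tendsto_of_tendsto' (hsum.hasSum.tendsto_sum_nat.const_mul _)
      (by simpa using ht.const_add L) hS
  exact (hsum.sum_le_tsum _ (fun k _ => sq_nonneg _)).trans h2

/-- mean square on the circle -/
def msq (H : ℂ → ℂ) (r : ℝ) : ℝ :=
  (2 * Real.pi)⁻¹ * ∫ θ in (0:ℝ)..(2 * Real.pi), ‖H (circleMap 0 r θ)‖ ^ 2

lemma L2rT_eq (H : ℂ → ℂ) (r : ℝ) : L2rT H r = Real.sqrt (msq H r) := by
  simp [L2rT, msq, circleMap]

lemma msq_nonneg (H : ℂ → ℂ) (r : ℝ) : 0 ≤ msq H r := by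
  unfold msq
  refine mul_nonneg (by positivity) ?_
  exact intervalIntegral.integral_nonneg (by positivity) fun _ _ => by positivity

lemma circ_mem (r : ℝ) (hr0 : 0 < r) (hr1 : r < 1) (θ : ℝ) :
    circleMap 0 r θ ∈ Metric.ball (0 : ℂ) 1 := by
  simp [abs_of_pos hr0, hr1]

lemma circ_cont (D : ℂ → ℂ) (r : ℝ) (hr0 : 0 < r) (hr1 : r < 1)
    (hD : DifferentiableOn ℂ D (Metric.ball 0 1)) : Continuous fun θ => D (circleMap 0 r θ) :=
  hD.continuousOn.comp_continuous (continuous_circleMap 0 r) (circ_mem r hr0 hr1)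

lemma orth (D : ℂ → ℂ) (r : ℝ) (hr0 : 0 < r) (hr1 : r < 1)
    (hD : DifferentiableOn ℂ D (Metric.ball 0 1)) :
    msq (fun z => D z - D 0) r + ‖D 0‖ ^ 2 = msq D r := by
  have hc := circ_cont D r hr0 hr1 hD
  have hsub : closedBall (0 : ℂ) r ⊆ ball 0 1 := closedBall_subset_ball hr1
  have hd : DiffContOnCl ℂ (fun z => (starRingEnd ℂ) (D 0) * D z) (ball 0 |r|) := by
    rw [abs_of_pos hr0]
    apply DifferentiableOn.diffContOnCl
    rw [closure_ball _ hr0.ne']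
    exact (hD.const_mul _).mono hsub
  have hav := hd.circleAverage
  rw [Real.circleAverage] at hav
  have hc2 : Continuous fun θ => (starRingEnd ℂ) (D 0) * D (circleMap 0 r θ) := hc.const_mul _
  have hre := congrArg Complex.re hav
  rw [Complex.smul_re] at hre
  have hre2 : (∫ θ in (0:ℝ)..(2 * Real.pi), (starRingEnd ℂ) (D 0) * D (circleMap 0 r θ)).re =
      ∫ θ in (0:ℝ)..(2 * Real.pi), ((starRingEnd ℂ) (D 0) * D (circleMap 0 r θ)).re := by
    have := Complex.reCLM.intervalIntegral_comp_comm (hc2.intervalIntegrable (μ := MeasureTheory.volume) 0 (2 * Real.pi))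
    exact this.symm
  rw [hre2] at hre
  have hdd : ((starRingEnd ℂ) (D 0) * D 0).re = ‖D 0‖ ^ 2 := by
    rw [Complex.sq_norm, Complex.normSq_apply]; simp
  rw [hdd, smul_eq_mul] at hre
  have hpt : ∀ θ, ‖D (circleMap 0 r θ) - D 0‖ ^ 2 = ‖D (circleMap 0 r θ)‖ ^ 2
      - 2 * ((starRingEnd ℂ) (D 0) * D (circleMap 0 r θ)).re + ‖D 0‖ ^ 2 := by
    intro θ
    simp only [Complex.sq_norm, Complex.normSq_apply]; simp; ring
  unfold msq
  simp only [hpt]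
  have c1 : Continuous fun θ => ‖D (circleMap 0 r θ)‖ ^ 2 := hc.norm.pow 2
  have c2 : Continuous fun θ => 2 * ((starRingEnd ℂ) (D 0) * D (circleMap 0 r θ)).re :=
    (Complex.continuous_re.comp hc2).const_mul 2
  have c12 : Continuous fun θ => ‖D (circleMap 0 r θ)‖ ^ 2 -
      2 * ((starRingEnd ℂ) (D 0) * D (circleMap 0 r θ)).re := c1.sub c2
  rw [intervalIntegral.integral_add (c12.intervalIntegrable _ _)
      (continuous_const.intervalIntegrable _ _),
    intervalIntegral.integral_sub (c1.intervalIntegrable _ _) (c2.intervalIntegrable _ _),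
    intervalIntegral.integral_const_mul, intervalIntegral.integral_const]
  simp only [smul_eq_mul, sub_zero]
  have hpi : (2 * Real.pi)⁻¹ * (2 * Real.pi) = 1 := inv_mul_cancel₀ (by positivity)
  linear_combination (-2 : ℝ) * hre + ‖D 0‖ ^ 2 * hpi

lemma stepInt (r s f g : ℝ) (hr0 : 0 < r) (hr1 : r < 1) (F G F1 G1 : ℂ → ℂ)
    (dF : DifferentiableOn ℂ F (Metric.ball 0 1)) (dG : DifferentiableOn ℂ G (Metric.ball 0 1))
    (dF1 : DifferentiableOn ℂ F1 (Metric.ball 0 1)) (dG1 : DifferentiableOn ℂ G1 (Metric.ball 0 1))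
    (hF : ∀ z ∈ ball (0 : ℂ) 1, z * F1 z * (1 - (starRingEnd ℂ) (F 0) * F z) = F z - F 0)
    (hG : ∀ z ∈ ball (0 : ℂ) 1, z * G1 z * (1 - (starRingEnd ℂ) (G 0) * G z) = G z - G 0)
    (hF1 : ∀ z ∈ ball (0 : ℂ) 1, ‖F z‖ ≤ 1) (hG1 : ∀ z ∈ ball (0 : ℂ) 1, ‖G z‖ ≤ 1)
    (hFf : ∀ z ∈ closedBall (0 : ℂ) r, ‖F z‖ ≤ f) (hGg : ∀ z ∈ closedBall (0 : ℂ) r, ‖G z‖ ≤ g)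
    (has : ‖F 0‖ ≤ s) (hbs : ‖G 0‖ ≤ s) (hs : s < 1) :
    r ^ 2 * msq (fun z => F1 z - G1 z) r ≤
      Real.exp (3 * f ^ 2 + g ^ 2 + (f ^ 2 + g ^ 2) / (1 - s)) ^ 2 *
        msq (fun z => F z - G z) r := by
  have h0 : (0 : ℂ) ∈ closedBall (0 : ℂ) r := by simp [hr0.le]
  have haf := hFf 0 h0
  have hbg := hGg 0 h0
  have hf0 : 0 ≤ f := (norm_nonneg _).trans haf
  have hg0 : 0 ≤ g := (norm_nonneg _).trans hbg
  set K := Real.exp ((f ^ 2 + g ^ 2) / (1 - s)) with hK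
  set q := f ^ 2 with hq
  set c := 2 * f * g + f ^ 2 with hc
  have hq0 : 0 ≤ q := by positivity
  have hc0 : 0 ≤ c := by positivity
  have dD := dF.sub dG
  have dD1 := dF1.sub dG1
  have ho := orth (fun z => F z - G z) r hr0 hr1 dD
  have cD : Continuous fun θ => F (circleMap 0 r θ) - G (circleMap 0 r θ) := circ_cont _ r hr0 hr1 dD
  have cD1 : Continuous fun θ => F1 (circleMap 0 r θ) - G1 (circleMap 0 r θ) := circ_cont _ r hr0 hr1 dD1
  have x1 : Continuous fun θ => ‖F (circleMap 0 r θ) - G (circleMap 0 r θ) - (F 0 - G 0)‖ ^ 2 :=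
    (cD.sub continuous_const).norm.pow 2
  have x2 : Continuous fun θ => q * ‖F (circleMap 0 r θ) - G (circleMap 0 r θ)‖ ^ 2 :=
    (cD.norm.pow 2).const_mul q
  have x12 : Continuous fun θ => ‖F (circleMap 0 r θ) - G (circleMap 0 r θ) - (F 0 - G 0)‖ ^ 2 +
      q * ‖F (circleMap 0 r θ) - G (circleMap 0 r θ)‖ ^ 2 := x1.add x2
  have mono : r ^ 2 * msq (fun z => F1 z - G1 z) r ≤ K ^ 2 * ((1 + q + c) *
      (msq (fun z => F z - G z - (F 0 - G 0)) r + q * msq (fun z => F z - G z) r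
        + c * ‖F 0 - G 0‖ ^ 2)) := by
    have hIle : ∫ θ in (0:ℝ)..(2 * Real.pi), r ^ 2 * ‖F1 (circleMap 0 r θ) - G1 (circleMap 0 r θ)‖ ^ 2
        ≤ ∫ θ in (0:ℝ)..(2 * Real.pi), K ^ 2 * ((1 + q + c) *
          (‖F (circleMap 0 r θ) - G (circleMap 0 r θ) - (F 0 - G 0)‖ ^ 2 +
            q * ‖F (circleMap 0 r θ) - G (circleMap 0 r θ)‖ ^ 2 + c * ‖F 0 - G 0‖ ^ 2)) := by
      apply intervalIntegral.integral_mono (by positivity)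
      · exact ((cD1.norm.pow 2).const_mul _).intervalIntegrable _ _
      · exact ((((x1.add x2).add continuous_const).const_mul _).const_mul _).intervalIntegrable _ _
      · intro θ
        have hb := circ_mem r hr0 hr1 θ
        have hcb : circleMap 0 r θ ∈ closedBall (0 : ℂ) r := by simp [abs_of_pos hr0]
        have := stepPt (circleMap 0 r θ) _ _ _ _ _ _ s f g (hF _ hb) (hG _ hb) (hFf _ hcb) (hGg _ hcb)
          haf hbg (hF1 _ hb) (hG1 _ hb) has hbs hs
        simpa [abs_of_pos hr0] using this
    rw [intervalIntegral.integral_const_mul, intervalIntegral.integral_const_mul,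
      intervalIntegral.integral_const_mul,
      intervalIntegral.integral_add (x12.intervalIntegrable _ _)
        (continuous_const.intervalIntegrable _ _),
      intervalIntegral.integral_add (x1.intervalIntegrable _ _) (x2.intervalIntegrable _ _),
      intervalIntegral.integral_const_mul, intervalIntegral.integral_const] at hIle
    simp only [smul_eq_mul, sub_zero] at hIle
    have hpi : (2 * Real.pi)⁻¹ * (2 * Real.pi) = 1 := inv_mul_cancel₀ (by positivity)
    have h3 := mul_le_mul_of_nonneg_left hIle (by positivity : 0 ≤ (2 * Real.pi)⁻¹)
    unfold msq
    refine (le_of_eq ?_).trans (h3.trans (le_of_eq ?_))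
    · ring
    · linear_combination K ^ 2 * (1 + q + c) * c * ‖F 0 - G 0‖ ^ 2 * hpi
  refine mono.trans ?_
  have hM := msq_nonneg (fun z => F z - G z) r
  have hM2 := msq_nonneg (fun z => F z - G z - (F 0 - G 0)) r
  have e1 : Real.exp (3 * q + g ^ 2 + (q + g ^ 2) / (1 - s)) = K * Real.exp (3 * q + g ^ 2) := by
    rw [Real.exp_add, mul_comm]
  rw [e1, mul_pow, mul_assoc]
  refine mul_le_mul_of_nonneg_left ?_ (by positivity)
  have e2 : 1 + q + c ≤ Real.exp (3 * q + g ^ 2) := by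
    have := Real.add_one_le_exp (3 * q + g ^ 2)
    nlinarith [sq_nonneg (f - g)]
  have e3 : msq (fun z => F z - G z - (F 0 - G 0)) r + q * msq (fun z => F z - G z) r
        + c * ‖F 0 - G 0‖ ^ 2 ≤ (1 + q + c) * msq (fun z => F z - G z) r := by
    have : c * ‖F 0 - G 0‖ ^ 2 ≤ c * msq (fun z => F z - G z) r :=
      mul_le_mul_of_nonneg_left (by linarith) hc0
    nlinarith [sq_nonneg ‖F 0 - G 0‖]
  calc _ ≤ (1 + q + c) * ((1 + q + c) * msq (fun z => F z - G z) r) := by gcongr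
    _ = (1 + q + c) ^ 2 * msq (fun z => F z - G z) r := by ring
    _ ≤ _ := by gcongr

lemma chain_facts (η r : ℝ) (hη0 : 0 < η) (hr0 : 0 < r) (hr1 : r < 1)
    (F : ℕ → ℂ → ℂ) (hF : IsSchurChain F) (hη : η ≤ szego F) :
    (∀ k, ‖F k 0‖ ≤ Real.sqrt (1 - η)) ∧ ∃ f : ℕ → ℝ,
      (∀ k, ∀ z ∈ closedBall (0 : ℂ) r, ‖F k z‖ ≤ f k) ∧
      ∀ n, ∑ k ∈ range n, f k ^ 2 ≤ Real.log (1 / η) / (1 - r) ^ 2 := by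
  have hpos : ∀ k, 0 < 1 - ‖F k 0‖ ^ 2 := fun k => by
    have := (hF k).2.2.1
    nlinarith [norm_nonneg (F k 0)]
  have hle1 : ∀ k, 1 - ‖F k 0‖ ^ 2 ≤ 1 := fun k => by nlinarith [sq_nonneg ‖F k 0‖]
  have hP0 : ∀ N, 0 < ∏ k ∈ range N, (1 - ‖F k 0‖ ^ 2) := fun N => prod_pos fun k _ => hpos k
  have hP : ∀ N, η ≤ ∏ k ∈ range N, (1 - ‖F k 0‖ ^ 2) := fun N =>
    hη.trans (ciInf_le ⟨0, by rintro _ ⟨M, rfl⟩; exact (hP0 M).le⟩ N)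
  have hsub : closedBall (0 : ℂ) r ⊆ ball 0 1 := closedBall_subset_ball hr1
  refine ⟨fun k => ?_, fun k => sSup ((fun z => ‖F k z‖) '' closedBall (0 : ℂ) r), ?_⟩
  · apply Real.le_sqrt_of_sq_le
    have h1 := hP (k + 1)
    rw [prod_range_succ] at h1
    have h2 : ∏ k ∈ range k, (1 - ‖F k 0‖ ^ 2) ≤ 1 :=
      prod_le_one (fun i _ => (hpos i).le) fun i _ => hle1 i
    nlinarith [hpos k]
  · have hub : ∀ k, ∀ z ∈ closedBall (0 : ℂ) r,
        ‖F k z‖ ≤ sSup ((fun z => ‖F k z‖) '' closedBall (0 : ℂ) r) := fun k z hz =>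
      le_csSup ⟨1, by rintro _ ⟨w, hw, rfl⟩; exact (hF k).2.1 w (hsub hw)⟩ ⟨z, hz, rfl⟩
    have h0 : (0 : ℂ) ∈ closedBall (0 : ℂ) r := by simp [hr0.le]
    have hne : ∀ k, ((fun z => ‖F k z‖) '' closedBall (0 : ℂ) r).Nonempty := fun k => ⟨_, 0, h0, rfl⟩
    refine ⟨hub, ?_⟩
    refine sumsq r _ hr0 hr1 (fun k => ‖F k 0‖) _ (fun k => norm_nonneg _)
      (fun k => (norm_nonneg _).trans (hub k 0 h0)) ?_ ?_ ?_
    · intro k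
      refine csSup_le (hne k) ?_
      rintro _ ⟨w, hw, rfl⟩
      exact (hF k).2.1 w (hsub hw)
    · intro k
      refine csSup_le (hne k) ?_
      rintro _ ⟨z, hz, rfl⟩
      have hrec := (hF k).2.2.2 z (hsub hz)
      have ha := (hF k).2.2.1
      have hz' : ‖z‖ ≤ r := by simpa using hz
      have hw1 : ‖F (k + 1) z‖ ≤ 1 := (hF (k + 1)).2.1 z (hsub hz)
      have hw : ‖z * F (k + 1) z‖ < 1 := by
        rw [norm_mul]; nlinarith [norm_nonneg z, norm_nonneg (F (k + 1) z)]
      have e : F k z * (1 + (starRingEnd ℂ) (F k 0) * (z * F (k + 1) z)) = F k 0 + z * F (k + 1) z := by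
        linear_combination -hrec
      have hp := pseudo (F k 0) (z * F (k + 1) z) ha.le hw.le
      rw [← e, norm_mul] at hp
      have hne0 : 0 < ‖1 + (starRingEnd ℂ) (F k 0) * (z * F (k + 1) z)‖ := by
        have h := norm_sub_norm_le 1 (-((starRingEnd ℂ) (F k 0) * (z * F (k + 1) z)))
        rw [norm_neg, norm_mul, RCLike.norm_conj, norm_one, sub_neg_eq_add] at h
        nlinarith [norm_nonneg (F k 0), norm_nonneg (z * F (k + 1) z)]
      have h5 := le_of_mul_le_mul_right hp hne0
      have h6 : ‖z * F (k + 1) z‖ ≤ r * sSup ((fun z => ‖F (k + 1) z‖) '' closedBall (0 : ℂ) r) := by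
        rw [norm_mul]
        exact mul_le_mul hz' (hub (k + 1) z hz) (norm_nonneg _) hr0.le
      show ‖F k z‖ ≤ _
      linarith
    · intro N
      have h1 : Real.log η ≤ Real.log (∏ k ∈ range N, (1 - ‖F k 0‖ ^ 2)) :=
        Real.log_le_log hη0 (hP N)
      rw [Real.log_prod (fun i _ => (hpos i).ne')] at h1
      have h2 : ∑ k ∈ range N, Real.log (1 - ‖F k 0‖ ^ 2) ≤ ∑ k ∈ range N, -(‖F k 0‖ ^ 2) :=
        sum_le_sum fun k _ => by linarith [Real.log_le_sub_one_of_pos (hpos k)]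
      rw [sum_neg_distrib] at h2
      rw [one_div, Real.log_inv]
      linarith

theorem stmt0 (η r : ℝ) (hη0 : 0 < η) (hη1 : η ≤ 1) (hr0 : 0 < r) (hr1 : r < 1)
    (F G : ℕ → ℂ → ℂ) (hF : IsSchurChain F) (hG : IsSchurChain G)
    (hηF : η ≤ szego F) (hηG : η ≤ szego G) (n : ℕ) :
    L2rT (fun z => F n z - G n z) r ≤
      Cconst η r * r ^ (-(n : ℤ)) * L2rT (fun z => F 0 z - G 0 z) r := by
  obtain ⟨hsF, f, hfF, hSf⟩ := chain_facts η r hη0 hr0 hr1 F hF hηF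
  obtain ⟨hsG, g, hgG, hSg⟩ := chain_facts η r hη0 hr0 hr1 G hG hηG
  set s := Real.sqrt (1 - η) with hs
  have hs1 : s < 1 := by rw [hs, Real.sqrt_lt' one_pos]; linarith
  set E : ℕ → ℝ := fun k => 3 * f k ^ 2 + g k ^ 2 + (f k ^ 2 + g k ^ 2) / (1 - s) with hE
  have hstep : ∀ k, r ^ 2 * msq (fun z => F (k + 1) z - G (k + 1) z) r ≤
      Real.exp (E k) ^ 2 * msq (fun z => F k z - G k z) r := fun k =>
    stepInt r s (f k) (g k) hr0 hr1 _ _ _ _ (hF k).1 (hG k).1 (hF (k + 1)).1 (hG (k + 1)).1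
      (hF k).2.2.2 (hG k).2.2.2 (hF k).2.1 (hG k).2.1 (hfF k) (hgG k) (hsF k) (hsG k) hs1
  have hind : ∀ n, (r ^ n) ^ 2 * msq (fun z => F n z - G n z) r ≤
      Real.exp (∑ k ∈ range n, E k) ^ 2 * msq (fun z => F 0 z - G 0 z) r := by
    intro n
    induction n with
    | zero => simp
    | succ k ih =>
      rw [sum_range_succ, Real.exp_add]
      calc _ = (r ^ k) ^ 2 * (r ^ 2 * msq (fun z => F (k + 1) z - G (k + 1) z) r) := by ring
        _ ≤ (r ^ k) ^ 2 * (Real.exp (E k) ^ 2 * msq (fun z => F k z - G k z) r) :=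
          mul_le_mul_of_nonneg_left (hstep k) (by positivity)
        _ = Real.exp (E k) ^ 2 * ((r ^ k) ^ 2 * msq (fun z => F k z - G k z) r) := by ring
        _ ≤ Real.exp (E k) ^ 2 * (Real.exp (∑ k ∈ range k, E k) ^ 2 *
            msq (fun z => F 0 z - G 0 z) r) := mul_le_mul_of_nonneg_left ih (by positivity)
        _ = _ := by ring
  have hL : 0 ≤ Real.log (1 / η) := Real.log_nonneg (by rw [le_div_iff₀ hη0]; linarith)
  have hEs : Real.exp (∑ k ∈ range n, E k) ≤ Cconst η r := by
    unfold Cconst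
    rw [Real.exp_le_exp, ← hs]
    have hsum : ∑ k ∈ range n, E k = 3 * ∑ k ∈ range n, f k ^ 2 + ∑ k ∈ range n, g k ^ 2 +
        (∑ k ∈ range n, f k ^ 2 + ∑ k ∈ range n, g k ^ 2) * (1 / (1 - s)) := by
      simp only [hE, sum_add_distrib, mul_sum, sum_mul, add_mul, div_eq_mul_inv, one_mul]
    rw [hsum]
    have hi : 0 ≤ 1 / (1 - s) := by rw [one_div, inv_nonneg]; linarith
    have h1 := hSf n
    have h2 := hSg n
    have hP : 0 ≤ Real.log (1 / η) / (1 - r) ^ 2 := by positivity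
    have e : Real.log (1 / η) * (2 + 1 / (1 - s)) * (4 / (1 - r) ^ 2 + 1) =
        4 * (Real.log (1 / η) / (1 - r) ^ 2) * (2 + 1 / (1 - s)) +
          Real.log (1 / η) * (2 + 1 / (1 - s)) := by ring
    rw [e]
    generalize Real.log (1 / η) / (1 - r) ^ 2 = P at *
    generalize 1 / (1 - s) = t at *
    have h3 := mul_le_mul_of_nonneg_right (add_le_add h1 h2) hi
    nlinarith [mul_nonneg hP hi, mul_nonneg hL hi]
  have hC : 0 ≤ Cconst η r := (Real.exp_pos _).le
  rw [L2rT_eq, L2rT_eq, zpow_neg, zpow_natCast, mul_right_comm, ← div_eq_mul_inv,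
    le_div_iff₀ (by positivity)]
  refine le_of_sq_le_sq ?_ (by positivity)
  rw [mul_pow, mul_pow, Real.sq_sqrt (msq_nonneg _ _), Real.sq_sqrt (msq_nonneg _ _), mul_comm]
  refine (hind n).trans ?_
  gcongr
  exact msq_nonneg _ _
end
end

section
/- Let (F_k)_{k≥0} be a Schur chain with Szegő constant η(F) > 0, and let r ∈ [0,1). Writing M_{F_k}(r) = max_{|z| ≤ r} |F_k(z)|, one has Σ_{k=0}^{∞} M_{F_k}(r)² ≤ (4/(1−r)²) · Σ_{k=0}^{∞} |F_k(0)|² ≤ (4/(1−r)²) · log(1/η(F)). -/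
open Complex Metric Finset Filter

noncomputable section

/-- `M_F(r)`: the supremum of `‖F z‖` over the closed disc `|z| ≤ r`. -/
def MF (F : ℂ → ℂ) (r : ℝ) : ℝ :=
  ⨆ z ∈ Metric.closedBall (0 : ℂ) r, ‖F z‖

theorem MF_nonneg' (f : ℂ → ℂ) (r : ℝ) : 0 ≤ MF f r :=
  Real.iSup_nonneg fun _ => Real.iSup_nonneg fun _ => norm_nonneg _

theorem MF_le' (f : ℂ → ℂ) (r c : ℝ) (hc : 0 ≤ c)
    (h : ∀ z ∈ Metric.closedBall (0 : ℂ) r, ‖f z‖ ≤ c) : MF f r ≤ c :=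
  Real.iSup_le (fun z => Real.iSup_le (fun hz => h z hz) hc) hc

theorem le_MF' (f : ℂ → ℂ) (r c : ℝ) (hc : 0 ≤ c)
    (h : ∀ z ∈ Metric.closedBall (0 : ℂ) r, ‖f z‖ ≤ c) (z : ℂ)
    (hz : z ∈ Metric.closedBall (0 : ℂ) r) : ‖f z‖ ≤ MF f r := by
  have hb : BddAbove (Set.range fun z : ℂ =>
      ⨆ (_ : z ∈ Metric.closedBall (0 : ℂ) r), ‖f z‖) := by
    refine ⟨c, ?_⟩
    rintro _ ⟨w, rfl⟩
    exact Real.iSup_le (fun hw => h w hw) hc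
  refine le_trans ?_ (le_ciSup hb z)
  exact le_of_eq (ciSup_pos (f := fun _ => ‖f z‖) hz).symm

theorem stmt2 (F : ℕ → ℂ → ℂ) (hF : IsSchurChain F) (hη : 0 < szego F)
    (r : ℝ) (hr0 : 0 ≤ r) (hr1 : r < 1) :
    Summable (fun k : ℕ => MF (F k) r ^ 2) ∧
    Summable (fun k : ℕ => ‖F k 0‖ ^ 2) ∧
    (∑' k : ℕ, MF (F k) r ^ 2) ≤ 4 / (1 - r) ^ 2 * ∑' k : ℕ, ‖F k 0‖ ^ 2 ∧
    4 / (1 - r) ^ 2 * (∑' k : ℕ, ‖F k 0‖ ^ 2) ≤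
      4 / (1 - r) ^ 2 * Real.log (1 / szego F) := by
  have hsub : ∀ z ∈ Metric.closedBall (0 : ℂ) r, z ∈ Metric.ball (0 : ℂ) 1 := fun z hz =>
    Metric.closedBall_subset_ball hr1 hz
  have hb : ∀ k, ∀ z ∈ Metric.closedBall (0 : ℂ) r, ‖F k z‖ ≤ 1 := fun k z hz =>
    (hF k).2.1 z (hsub z hz)
  have hM0 : ∀ k, 0 ≤ MF (F k) r := fun k => MF_nonneg' _ _
  have hM1 : ∀ k, MF (F k) r ≤ 1 := fun k => MF_le' _ _ _ zero_le_one (hb k)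
  have hs : 0 < 1 - r := by linarith
  have hrec : ∀ k, MF (F k) r ≤ 2 * ‖F k 0‖ + r * MF (F (k + 1)) r := by
    intro k
    have ha := norm_nonneg (F k 0)
    refine MF_le' _ _ _ (by have := mul_nonneg hr0 (hM0 (k + 1)); linarith) ?_
    intro z hz
    have h1 := (hF k).2.2.2 z (hsub z hz)
    have hz' : ‖z‖ ≤ r := by simpa using hz
    have h2 := le_MF' _ _ _ zero_le_one (hb (k + 1)) z hz
    have h3 : ‖1 - (starRingEnd ℂ) (F k 0) * F k z‖ ≤ 1 + ‖F k 0‖ := by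
      refine (norm_sub_le _ _).trans ?_
      rw [norm_one, norm_mul, RCLike.norm_conj]
      have := mul_le_of_le_one_right ha (hb k z hz)
      linarith
    have h4 : ‖F k z‖ ≤ ‖F k 0‖ + ‖z * F (k + 1) z * (1 - (starRingEnd ℂ) (F k 0) * F k z)‖ := by
      have h5 : F k z = F k 0 + z * F (k + 1) z * (1 - (starRingEnd ℂ) (F k 0) * F k z) := by
        rw [h1]; ring
      calc ‖F k z‖ = ‖F k 0 + z * F (k + 1) z * (1 - (starRingEnd ℂ) (F k 0) * F k z)‖ := by
            rw [← h5]
        _ ≤ _ := norm_add_le _ _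
    rw [norm_mul, norm_mul] at h4
    have h6 : ‖z‖ * ‖F (k + 1) z‖ ≤ r * MF (F (k + 1)) r :=
      mul_le_mul hz' h2 (norm_nonneg _) hr0
    have h0 : 0 ≤ r * MF (F (k + 1)) r := mul_nonneg hr0 (hM0 _)
    have h7 := mul_le_mul h6 h3 (norm_nonneg _) h0
    have h8 : r * MF (F (k + 1)) r ≤ 1 := mul_le_one₀ hr1.le (hM0 _) (hM1 _)
    nlinarith [mul_le_mul_of_nonneg_right h8 ha]
  have hsq : ∀ k, MF (F k) r ^ 2 ≤ 4 / (1 - r) * ‖F k 0‖ ^ 2 + r * MF (F (k + 1)) r ^ 2 := by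
    intro k
    have h1 : MF (F k) r ^ 2 ≤ (2 * ‖F k 0‖ + r * MF (F (k + 1)) r) ^ 2 :=
      pow_le_pow_left₀ (hM0 k) (hrec k) 2
    refine h1.trans ?_
    have h2 : 4 / (1 - r) * ‖F k 0‖ ^ 2 + r * MF (F (k + 1)) r ^ 2
        - (2 * ‖F k 0‖ + r * MF (F (k + 1)) r) ^ 2
        = r / (1 - r) * (2 * ‖F k 0‖ - (1 - r) * MF (F (k + 1)) r) ^ 2 := by
      field_simp
      ring
    have h3 : 0 ≤ r / (1 - r) * (2 * ‖F k 0‖ - (1 - r) * MF (F (k + 1)) r) ^ 2 := by positivity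
    linarith
  have hfac : ∀ k, 0 < 1 - ‖F k 0‖ ^ 2 := by
    intro k
    have h1 := (hF k).2.2.1
    have h2 := norm_nonneg (F k 0)
    nlinarith
  have hpart : ∀ N, ∑ k ∈ Finset.range N, ‖F k 0‖ ^ 2 ≤ Real.log (1 / szego F) := by
    intro N
    have h1 : szego F ≤ ∏ k ∈ Finset.range N, (1 - ‖F k 0‖ ^ 2) := by
      refine ciInf_le ⟨0, ?_⟩ N
      rintro _ ⟨n, rfl⟩
      exact Finset.prod_nonneg fun k _ => (hfac k).le
    have h2 := Real.log_le_log hη h1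
    rw [Real.log_prod fun k _ => (hfac k).ne'] at h2
    have h3 : ∑ k ∈ Finset.range N, Real.log (1 - ‖F k 0‖ ^ 2)
        ≤ ∑ k ∈ Finset.range N, -‖F k 0‖ ^ 2 := by
      refine Finset.sum_le_sum fun k _ => ?_
      have := Real.log_le_sub_one_of_pos (hfac k)
      linarith
    rw [Finset.sum_neg_distrib] at h3
    rw [one_div, Real.log_inv]
    linarith
  have hA : Summable (fun k : ℕ => ‖F k 0‖ ^ 2) :=
    summable_of_sum_range_le (fun k => sq_nonneg _) hpart
  have hAl : (∑' k : ℕ, ‖F k 0‖ ^ 2) ≤ Real.log (1 / szego F) :=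
    hA.tsum_le_of_sum_range_le hpart
  have hS : Summable (fun k : ℕ => MF (F k) r ^ 2) := by
    refine summable_of_sum_range_le (c := (4 / (1 - r) * Real.log (1 / szego F) + 1) / (1 - r))
      (fun k => sq_nonneg _) fun N => ?_
    have h1 : ∑ k ∈ Finset.range N, MF (F k) r ^ 2 ≤ 4 / (1 - r) * ∑ k ∈ Finset.range N, ‖F k 0‖ ^ 2
        + r * ∑ k ∈ Finset.range N, MF (F (k + 1)) r ^ 2 := by
      rw [Finset.mul_sum, Finset.mul_sum, ← Finset.sum_add_distrib]
      exact Finset.sum_le_sum fun k _ => hsq k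
    have h2 := Finset.sum_range_succ (fun k => MF (F k) r ^ 2) N
    rw [Finset.sum_range_succ'] at h2
    have h3 : MF (F N) r ^ 2 ≤ 1 := pow_le_one₀ (hM0 N) (hM1 N)
    have h4 : ∑ k ∈ Finset.range N, MF (F (k + 1)) r ^ 2
        ≤ ∑ k ∈ Finset.range N, MF (F k) r ^ 2 + 1 := by
      have := sq_nonneg (MF (F 0) r)
      linarith
    have h5 := mul_le_mul_of_nonneg_left h4 hr0
    have h6 := mul_le_mul_of_nonneg_left (hpart N) (by positivity : 0 ≤ 4 / (1 - r))
    rw [le_div_iff₀ hs]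
    linarith
  refine ⟨hS, hA, ?_, mul_le_mul_of_nonneg_left hAl (by positivity)⟩
  have hS' : Summable (fun k : ℕ => MF (F (k + 1)) r ^ 2) :=
    (summable_nat_add_iff (f := fun k : ℕ => MF (F k) r ^ 2) 1).2 hS
  have h1 := hS.tsum_le_tsum hsq ((hA.mul_left _).add (hS'.mul_left _))
  rw [(hA.mul_left _).tsum_add (hS'.mul_left _), tsum_mul_left, tsum_mul_left] at h1
  have h2 := hS.tsum_eq_zero_add
  have h3 : (∑' k : ℕ, MF (F (k + 1)) r ^ 2) ≤ ∑' k : ℕ, MF (F k) r ^ 2 := by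
    have := sq_nonneg (MF (F 0) r)
    linarith
  have h4 := mul_le_mul_of_nonneg_left h3 hr0
  have h5 : 4 / (1 - r) ^ 2 * (∑' k : ℕ, ‖F k 0‖ ^ 2)
      = (4 / (1 - r) * ∑' k : ℕ, ‖F k 0‖ ^ 2) / (1 - r) := by
    field_simp
  rw [h5, le_div_iff₀ hs]
  linarith
end
end

section
/- Let n be an integer and t > 0 a real number with n > t and δ_{n,t} < 1. Then for every z on the unit circle 𝕋 one has |G_{n,t}(z)| ≤ 1 − δ_{n,t}²; in particular |G_{n,t}(z)| < 1. -/
open Complex Metric Finset Filter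

noncomputable section

/-- The Fourier coefficient `c_k(t) = ∫_𝕋 e^{it(ξ + 1/ξ)} ξ^{-k} dm(ξ)`
(equal to `i^k J_k(2t)` with `J_k` the Bessel function of order `k`). -/
def ck (t : ℝ) (k : ℤ) : ℂ :=
  (2 * Real.pi)⁻¹ •
    ∫ θ in (0:ℝ)..(2 * Real.pi),
      Complex.exp (Complex.I * t * (Complex.exp (θ * Complex.I) +
        (Complex.exp (θ * Complex.I))⁻¹)) * (Complex.exp (θ * Complex.I)) ^ (-k)

/-- The Laurent polynomial `P_{n,t}(z) = Σ_{k=-n}^{n} c_k(t) z^k`. -/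
def Pnt (n : ℕ) (t : ℝ) (z : ℂ) : ℂ :=
  ∑ k ∈ Finset.Icc (-(n : ℤ)) (n : ℤ), ck t k * z ^ k

/-- `δ_{n,t} = tⁿ eᵗ / n!`. -/
def deltant (n : ℕ) (t : ℝ) : ℝ :=
  t ^ n * Real.exp t / (Nat.factorial n : ℝ)

/-- `G_{n,t}(z) = (1 - δ_{n,t}) zⁿ P_{n,t}(z)`. -/
def Gnt (n : ℕ) (t : ℝ) (z : ℂ) : ℂ :=
  ((1 - deltant n t : ℝ) : ℂ) * z ^ n * Pnt n t z


/-- The integrand of `ck`. -/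
def auxW (t : ℝ) (k : ℤ) (θ : ℝ) : ℂ :=
  Complex.exp (Complex.I * t * (Complex.exp (θ * Complex.I) +
        (Complex.exp (θ * Complex.I))⁻¹)) * (Complex.exp (θ * Complex.I)) ^ (-k)

lemma aux_ck (t : ℝ) (k : ℤ) :
    ck t k = (2 * Real.pi)⁻¹ • ∫ θ in (0:ℝ)..(2 * Real.pi), auxW t k θ := rfl

lemma aux_cont (t : ℝ) (k : ℤ) : Continuous (auxW t k) := by
  unfold auxW
  have h : ∀ x : ℝ, Complex.exp (x * Complex.I) ≠ 0 := fun x => Complex.exp_ne_zero _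
  fun_prop (disch := simp)

lemma aux_int (t : ℝ) (k : ℤ) (a b : ℝ) :
    IntervalIntegrable (auxW t k) MeasureTheory.volume a b :=
  (aux_cont t k).intervalIntegrable a b

lemma aux_norm_exp (t θ : ℝ) : ‖Complex.exp (Complex.I * t * (Complex.exp (θ * Complex.I) +
        (Complex.exp (θ * Complex.I))⁻¹))‖ = 1 := by
  have h : Complex.I * t * (Complex.exp (θ * Complex.I) + (Complex.exp (θ * Complex.I))⁻¹)
      = ((t * (2 * Real.cos θ) : ℝ) : ℂ) * Complex.I := by
    push_cast
    rw [← Complex.exp_neg, Complex.two_cos]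
    ring_nf
  rw [h, Complex.norm_exp_ofReal_mul_I]

lemma aux_norm (t : ℝ) (k : ℤ) (θ : ℝ) : ‖auxW t k θ‖ = 1 := by
  rw [auxW, norm_mul, aux_norm_exp, norm_zpow, Complex.norm_exp_ofReal_mul_I, one_zpow, mul_one]

lemma aux_W_shift (t : ℝ) (k : ℤ) (θ : ℝ) :
    auxW t k θ * Complex.exp (θ * Complex.I) = auxW t (k - 1) θ := by
  rw [auxW, auxW, mul_assoc, ← zpow_add_one₀ (Complex.exp_ne_zero _)]
  congr 2
  ring

lemma aux_W_shift2 (t : ℝ) (k : ℤ) (θ : ℝ) :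
    auxW t k θ * (Complex.exp (θ * Complex.I))⁻¹ = auxW t (k + 1) θ := by
  rw [auxW, auxW, mul_assoc, ← zpow_sub_one₀ (Complex.exp_ne_zero _)]
  congr 2
  ring

lemma aux_deriv_t (t : ℝ) (k : ℤ) (θ : ℝ) :
    HasDerivAt (fun s : ℝ => auxW s k θ)
      (Complex.I * (auxW t (k - 1) θ + auxW t (k + 1) θ)) t := by
  rw [← aux_W_shift, ← aux_W_shift2]
  unfold auxW
  have h1 : HasDerivAt (fun s : ℝ => Complex.I * (s : ℂ) * (Complex.exp (θ * Complex.I) +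
        (Complex.exp (θ * Complex.I))⁻¹)) (Complex.I * 1 * (Complex.exp (θ * Complex.I) +
        (Complex.exp (θ * Complex.I))⁻¹)) t :=
    ((Complex.ofRealCLM.hasDerivAt (x := t)).const_mul Complex.I).mul_const _
  have h2 := (h1.cexp).mul_const ((Complex.exp (θ * Complex.I)) ^ (-k))
  refine HasDerivAt.congr_deriv (by exact h2) ?_
  ring

lemma aux_deriv_theta (t : ℝ) (k : ℤ) (θ : ℝ) :
    HasDerivAt (fun x : ℝ => auxW t k x)
      (-t * auxW t (k - 1) θ + t * auxW t (k + 1) θ - Complex.I * k * auxW t k θ) θ := by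
  rw [← aux_W_shift, ← aux_W_shift2]
  unfold auxW
  have h0 : HasDerivAt (fun x : ℝ => Complex.exp (x * Complex.I))
      (Complex.exp (θ * Complex.I) * (1 * Complex.I)) θ :=
    ((Complex.ofRealCLM.hasDerivAt (x := θ)).mul_const Complex.I).cexp
  have hne := Complex.exp_ne_zero (θ * Complex.I)
  have h1 := ((h0.add (h0.inv hne)).const_mul (Complex.I * (t : ℂ))).cexp
  have h2 := (hasDerivAt_zpow (-k) (Complex.exp (θ * Complex.I)) (Or.inl hne)).comp θ h0
  have h3 := h1.mul h2
  refine HasDerivAt.congr_deriv (by exact h3) ?_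
  simp only [Function.comp_apply, Pi.add_apply, Pi.inv_apply]
  rw [zpow_sub_one₀ hne]
  set e := Complex.exp (θ * Complex.I)
  set w := Complex.exp (Complex.I * t * (e + e⁻¹))
  set p := e ^ (-k)
  push_cast
  field_simp
  ring_nf
  simp only [Complex.I_sq]
  ring

lemma aux_ibp (t : ℝ) (k : ℤ) :
    (k : ℂ) * ck t k = Complex.I * t * (ck t (k - 1) - ck t (k + 1)) := by
  have h := intervalIntegral.integral_eq_sub_of_hasDerivAt (a := 0) (b := 2 * Real.pi)
    (fun x _ => aux_deriv_theta t k x)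
    (by
      apply Continuous.intervalIntegrable
      have := aux_cont t k
      have := aux_cont t (k-1)
      have := aux_cont t (k+1)
      fun_prop)
  have he : auxW t k (2 * Real.pi) - auxW t k 0 = 0 := by
    simp [auxW, Complex.exp_two_pi_mul_I]
  rw [he, intervalIntegral.integral_sub, intervalIntegral.integral_add,
    intervalIntegral.integral_const_mul, intervalIntegral.integral_const_mul,
    intervalIntegral.integral_const_mul] at h
  · simp only [aux_ck, Complex.real_smul]
    linear_combination Complex.I * ((2 * Real.pi)⁻¹ : ℝ) * h +
      (k : ℂ) * ((2 * Real.pi)⁻¹ : ℝ) * (∫ θ in (0:ℝ)..(2 * Real.pi), auxW t k θ) * Complex.I_sq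
  · exact (aux_int _ _ _ _).const_mul _
  · exact (aux_int _ _ _ _).const_mul _
  · exact ((aux_int _ _ _ _).const_mul _).add ((aux_int _ _ _ _).const_mul _)
  · exact (aux_int _ _ _ _).const_mul _

lemma aux_deriv (t : ℝ) (k : ℤ) :
    HasDerivAt (fun s : ℝ => ck s k) (Complex.I * (ck t (k - 1) + ck t (k + 1))) t := by
  have h := (intervalIntegral.hasDerivAt_integral_of_dominated_loc_of_deriv_le
    (μ := MeasureTheory.volume) (a := 0) (b := 2 * Real.pi)
    (F := fun s θ => auxW s k θ)
    (F' := fun s θ => Complex.I * (auxW s (k - 1) θ + auxW s (k + 1) θ)) (x₀ := t)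
    (s := Set.univ) (bound := fun _ => 2) Filter.univ_mem
    (Filter.Eventually.of_forall fun s => (aux_cont s k).aestronglyMeasurable)
    (aux_int _ _ _ _)
    (((aux_cont t (k-1)).add (aux_cont t (k+1))).const_mul _).aestronglyMeasurable
    (Filter.Eventually.of_forall fun θ _ s _ => by
      rw [norm_mul, Complex.norm_I, one_mul]
      refine (norm_add_le _ _).trans ?_
      rw [aux_norm, aux_norm]; norm_num)
    (by simp)
    (Filter.Eventually.of_forall fun θ _ s _ => aux_deriv_t s k θ)).2
  have h2 := h.const_smul ((2 * Real.pi)⁻¹ : ℝ)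
  refine HasDerivAt.congr_deriv (by exact h2) ?_
  rw [intervalIntegral.integral_const_mul, intervalIntegral.integral_add
    (aux_int _ _ _ _) (aux_int _ _ _ _)]
  simp only [aux_ck, Complex.real_smul]
  ring

lemma aux_bound_zero (t : ℝ) (k : ℤ) : ‖ck t k‖ ≤ 1 := by
  rw [aux_ck, norm_smul]
  have h := intervalIntegral.norm_integral_le_of_norm_le_const (a := 0) (b := 2 * Real.pi)
    (f := auxW t k) (C := 1) (fun x _ => (aux_norm t k x).le)
  have hp := Real.pi_pos
  rw [sub_zero, abs_of_pos (by positivity), one_mul] at h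
  rw [Real.norm_of_nonneg (by positivity), inv_mul_le_iff₀ (by positivity)]
  linarith

lemma aux_bound (k : ℕ) : ∀ t : ℝ, 0 < t → ‖ck t k‖ ≤ t ^ k / (Nat.factorial k : ℝ) := by
  induction k with
  | zero => intro t _; simpa using aux_bound_zero t 0
  | succ k ih =>
    intro t ht
    have hd : ∀ s : ℝ, HasDerivAt (fun s : ℝ => (s : ℂ) ^ (k + 1) * ck s ((k + 1 : ℕ) : ℤ))
        (2 * Complex.I * (s : ℂ) ^ (k + 1) * ck s k) s := by
      intro s
      have h1 := ((Complex.ofRealCLM.hasDerivAt (x := s)).pow (k + 1)).mul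
        (aux_deriv s ((k + 1 : ℕ) : ℤ))
      have h2 := aux_ibp s ((k + 1 : ℕ) : ℤ)
      refine HasDerivAt.congr_deriv (by exact h1) ?_
      simp only [Complex.ofRealCLM_apply, Pi.pow_apply]
      have e1 : (((k + 1 : ℕ) : ℤ) - 1) = k := by push_cast; ring
      rw [e1] at h2 ⊢
      push_cast at h2 ⊢
      simp only [Nat.add_sub_cancel, pow_succ]
      linear_combination ((s : ℂ) ^ k) * h2
    have hB : ∀ s : ℝ, HasDerivAt (fun s : ℝ => s ^ (2 * k + 2) / (Nat.factorial (k + 1) : ℝ))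
        (2 * s ^ (2 * k + 1) / (Nat.factorial k : ℝ)) s := by
      intro s
      have h := (hasDerivAt_pow (2 * k + 2) s).div_const (Nat.factorial (k + 1) : ℝ)
      refine HasDerivAt.congr_deriv (by exact h) ?_
      rw [Nat.factorial_succ]
      have : (Nat.factorial k : ℝ) ≠ 0 := by positivity
      have : (k : ℝ) + 1 ≠ 0 := by positivity
      push_cast
      field_simp
    have h := image_norm_le_of_norm_deriv_right_le_deriv_boundary (a := 0) (b := t)
      (fun s _ => (hd s).continuousAt.continuousWithinAt)
      (fun s _ => (hd s).hasDerivWithinAt) (by simp) hB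
      (fun s hs => by
        rcases hs.1.eq_or_lt with rfl | h0
        · simp
        · have := ih s h0
          rw [norm_mul, norm_mul, norm_mul, Complex.norm_I, norm_pow, Complex.norm_real,
            Real.norm_of_nonneg h0.le]
          simp only [Complex.norm_ofNat, mul_one]
          calc 2 * s ^ (k + 1) * ‖ck s k‖ ≤ 2 * s ^ (k + 1) * (s ^ k / (Nat.factorial k : ℝ)) := by
                gcongr
            _ = _ := by ring)
      (Set.right_mem_Icc.2 ht.le)
    rw [norm_mul, norm_pow, Complex.norm_real, Real.norm_of_nonneg ht.le] at h
    have hp : 0 < t ^ (k + 1) := by positivity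
    refine le_of_mul_le_mul_left (h.trans (le_of_eq ?_)) hp
    ring

lemma aux_symm (t : ℝ) (k : ℤ) : ck t (-k) = ck t k := by
  rw [aux_ck, aux_ck]
  congr 1
  have h := intervalIntegral.integral_comp_sub_left (a := 0) (b := 2 * Real.pi)
    (auxW t k) (2 * Real.pi)
  simp only [sub_self, sub_zero] at h
  rw [← h]
  refine intervalIntegral.integral_congr fun θ _ => ?_
  have e : Complex.exp (((2 * Real.pi - θ : ℝ) : ℂ) * Complex.I)
      = (Complex.exp (θ * Complex.I))⁻¹ := by
    push_cast
    rw [sub_mul, Complex.exp_sub, Complex.exp_two_pi_mul_I, one_div]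
  simp only [auxW, e, inv_inv, inv_zpow', neg_neg]
  rw [add_comm]

lemma aux_summable (t : ℝ) (ht : 0 < t) : Summable (fun k : ℤ => ck t k) := by
  have h : Summable (fun k : ℕ => ck t (k : ℤ)) :=
    Summable.of_norm_bounded (Real.summable_pow_div_factorial t) (fun k => aux_bound k t ht)
  refine Summable.of_nat_of_neg h ?_
  simpa only [aux_symm] using h

instance aux_fact : Fact (0 < 2 * Real.pi) := ⟨by positivity⟩

lemma aux_fourier (k : ℤ) (x : ℝ) :
    fourier k (x : AddCircle (2 * Real.pi)) = Complex.exp (x * Complex.I) ^ k := by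
  rw [fourier_coe_apply, ← Complex.exp_int_mul]
  congr 1
  have : (Real.pi : ℂ) ≠ 0 := by exact_mod_cast Real.pi_ne_zero
  push_cast
  field_simp

lemma aux_hasSum (t : ℝ) (ht : 0 < t) (x : ℝ) :
    HasSum (fun k : ℤ => ck t k * Complex.exp (x * Complex.I) ^ k)
      (Complex.exp (Complex.I * t * (Complex.exp (x * Complex.I) +
        (Complex.exp (x * Complex.I))⁻¹))) := by
  let f : C(AddCircle (2 * Real.pi), ℂ) :=
    ⟨fun y => Complex.exp (Complex.I * t * (fourier 1 y + fourier (-1) y)), by fun_prop⟩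
  have hf : ∀ y : ℝ, f (y : AddCircle (2 * Real.pi)) =
      Complex.exp (Complex.I * t * (Complex.exp (y * Complex.I) +
        (Complex.exp (y * Complex.I))⁻¹)) := by
    intro y
    simp only [f, ContinuousMap.coe_mk, aux_fourier, zpow_one, zpow_neg]
  have hc : fourierCoeff f = fun k => ck t k := by
    funext k
    rw [fourierCoeff_eq_intervalIntegral _ k 0, zero_add, one_div, aux_ck]
    congr 1
    refine intervalIntegral.integral_congr fun θ _ => ?_
    simp only [hf, aux_fourier, auxW, smul_eq_mul]
    rw [mul_comm]
  have h := has_pointwise_sum_fourier_series_of_summable (f := f)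
    (by rw [hc]; exact aux_summable t ht) (x : AddCircle (2 * Real.pi))
  rw [hf, hc] at h
  simpa only [aux_fourier, smul_eq_mul] using h

lemma aux_fact_ineq (n m : ℕ) (hn : 1 ≤ n) :
    2 * (Nat.factorial n * Nat.factorial (m + 1)) ≤ Nat.factorial (n + m + 1) := by
  have h := Nat.add_choose_mul_factorial_mul_factorial n (m + 1)
  have h1 : 0 < (n + (m + 1)).choose n := Nat.choose_pos (by omega)
  have h2 : (n + (m + 1)).choose n ≠ 1 := by
    rw [Ne, Nat.choose_eq_one_iff]; omega
  have h3 : 2 ≤ (n + (m + 1)).choose n := by omega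
  rw [add_assoc, ← h, mul_assoc]
  refine Nat.mul_le_mul_right _ ?_
  first | exact h3 | (rw [Nat.choose_symm_add] at h3; exact h3) | (rw [← Nat.choose_symm_add] at h3; exact h3)

lemma aux_step (n m : ℕ) (hn : 1 ≤ n) (t : ℝ) (ht : 0 < t) :
    2 * (t ^ (n + m + 1) / (Nat.factorial (n + m + 1) : ℝ)) ≤
      t ^ n / (Nat.factorial n : ℝ) * (t ^ (m + 1) / (Nat.factorial (m + 1) : ℝ)) := by
  have h : 2 * ((Nat.factorial n : ℝ) * Nat.factorial (m + 1)) ≤ Nat.factorial (n + m + 1) := by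
    exact_mod_cast aux_fact_ineq n m hn
  rw [div_mul_div_comm, ← pow_add, ← add_assoc, ← mul_div_assoc,
    div_le_div_iff₀ (by positivity) (by positivity)]
  have hp : 0 ≤ t ^ (n + m + 1) := by positivity
  nlinarith [mul_le_mul_of_nonneg_left h hp]

lemma aux_partial (n : ℕ) (hn : 1 ≤ n) (t : ℝ) (ht : 0 < t) (z : ℂ) (hz : ‖z‖ = 1) (m : ℕ) :
    ‖Pnt n t z‖ ≤ ‖Pnt (n + m) t z‖ + t ^ n / (Nat.factorial n : ℝ) *
      ∑ j ∈ Finset.range m, t ^ (j + 1) / (Nat.factorial (j + 1) : ℝ) := by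
  induction m with
  | zero => simp
  | succ m ih =>
    rw [Finset.sum_range_succ, mul_add]
    have hs := aux_step n m hn t ht
    have hP : Pnt (n + m) t z = Pnt (n + (m + 1)) t z -
        (ck t ((n + m + 1 : ℕ) : ℤ) * z ^ ((n + m + 1 : ℕ) : ℤ) +
          ck t (-((n + m + 1 : ℕ) : ℤ)) * z ^ (-((n + m + 1 : ℕ) : ℤ))) := by
      unfold Pnt
      have := Finset.sum_Icc_succ_eq_add_endpoints (fun k : ℤ => ck t k * z ^ k) (N := n + m)
      push_cast at this ⊢
      rw [← add_assoc, this]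
      ring
    have hb := aux_bound (n + m + 1) t ht
    have h1 : ‖Pnt (n + m) t z‖ ≤ ‖Pnt (n + (m + 1)) t z‖ +
        2 * (t ^ (n + m + 1) / (Nat.factorial (n + m + 1) : ℝ)) := by
      rw [hP]
      refine (norm_sub_le _ _).trans ?_
      gcongr
      refine (norm_add_le _ _).trans ?_
      rw [aux_symm, norm_mul, norm_mul, norm_zpow, norm_zpow, hz, one_zpow, one_zpow]
      linarith
    linarith

lemma aux_P (n : ℕ) (t : ℝ) (ht : 0 < t) (hnt : t < (n : ℝ)) (z : ℂ) (hz : ‖z‖ = 1) :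
    ‖Pnt n t z‖ ≤ 1 + deltant n t := by
  have hn : 1 ≤ n := by
    have : (0 : ℝ) < n := ht.trans hnt
    exact_mod_cast this
  obtain ⟨x, rfl⟩ : ∃ x : ℝ, Complex.exp (x * Complex.I) = z := (Complex.norm_eq_one_iff z).1 hz
  have hsum := aux_hasSum t ht x
  have hT : Tendsto (fun N : ℕ => Pnt N t (Complex.exp (x * Complex.I))) atTop
      (nhds (Complex.exp (Complex.I * t * (Complex.exp (x * Complex.I) +
        (Complex.exp (x * Complex.I))⁻¹)))) :=
    by
    unfold HasSum at hsum
    rw [SummationFilter.unconditional_filter] at hsum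
    exact hsum.comp (Finset.tendsto_Icc_neg (R := ℤ))
  have hT2 : Tendsto (fun m : ℕ => ‖Pnt (n + m) t (Complex.exp (x * Complex.I))‖ + deltant n t)
      atTop (nhds (1 + deltant n t)) := by
    have h := (hT.comp (tendsto_add_atTop_nat n)).norm
    rw [aux_norm_exp] at h
    refine Tendsto.add_const _ ?_
    refine h.congr fun m => ?_
    simp only [Function.comp_apply, add_comm]
  refine ge_of_tendsto' hT2 fun m => ?_
  refine (aux_partial n hn t ht _ hz m).trans ?_
  have hexp : ∑ j ∈ Finset.range m, t ^ (j + 1) / (Nat.factorial (j + 1) : ℝ) ≤ Real.exp t := by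
    have h := Real.sum_le_exp_of_nonneg ht.le (m + 1)
    rw [Finset.sum_range_succ'] at h
    simp at h
    linarith
  have : t ^ n / (Nat.factorial n : ℝ) *
      ∑ j ∈ Finset.range m, t ^ (j + 1) / (Nat.factorial (j + 1) : ℝ) ≤ deltant n t := by
    rw [deltant, mul_div_right_comm]
    gcongr
  linarith

theorem stmt3 (n : ℕ) (t : ℝ) (ht : 0 < t) (hnt : t < (n : ℝ))
    (hδ : deltant n t < 1) :
    ∀ z : ℂ, ‖z‖ = 1 →
      ‖Gnt n t z‖ ≤ 1 - deltant n t ^ 2 ∧ ‖Gnt n t z‖ < 1 := by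
  intro z hz
  have hP : ‖Pnt n t z‖ ≤ 1 + deltant n t := aux_P n t ht hnt z hz
  have hG : ‖Gnt n t z‖ = (1 - deltant n t) * ‖Pnt n t z‖ := by
    rw [Gnt, norm_mul, norm_mul, norm_pow, hz, one_pow, mul_one, Complex.norm_real,
      Real.norm_of_nonneg (by linarith)]
  have hpos : 0 < deltant n t := by unfold deltant; positivity
  have h1 : ‖Gnt n t z‖ ≤ 1 - deltant n t ^ 2 := by
    rw [hG]; nlinarith
  exact ⟨h1, by nlinarith⟩
end
end

section
/- Let n be an integer and t > 0 a real number with n > t and δ_{n,t} < 1, and let r ∈ (0,1). Then max_{|z| = r} |G_{n,t}(z)| ≤ e^{t/r} · (rⁿ + 3·δ_{n,t}), and moreover max_{|z| = r} |G_{n+1,t}(z) − z·G_{n,t}(z)| ≤ 6·δ_{n,t}·e^{t/r}. -/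
open Complex Metric Finset Filter

noncomputable section

lemma hs_congrC {f g : ℕ × ℕ → ℂ} {a b : ℂ} (h : HasSum f a) (hf : ∀ p, g p = f p) (hb : b = a) :
    HasSum g b := by
  have : g = f := funext hf
  rw [this, hb]; exact h

lemma hs_congrR {f g : ℕ × ℕ → ℝ} {a b : ℝ} (h : HasSum f a) (hf : ∀ p, g p = f p) (hb : b = a) :
    HasSum g b := by
  have : g = f := funext hf
  rw [this, hb]; exact h

lemma hs_mulC {f g : ℕ → ℂ} {a b : ℂ} (hf : HasSum f a) (hg : HasSum g b)
    (hf' : Summable (fun n => ‖f n‖)) (hg' : Summable (fun n => ‖g n‖)) :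
    HasSum (fun p : ℕ × ℕ => f p.1 * g p.2) (a * b) :=
  hf.mul hg (summable_mul_of_summable_norm hf' hg')

lemma hs_subC {f g : ℕ × ℕ → ℂ} {a b : ℂ} (hf : HasSum f a) (hg : HasSum g b) (c : ℂ) :
    HasSum (fun p => c * (f p - g p)) (c * (a - b)) :=
  (hf.sub hg).mul_left c

lemma hs_swap {f : ℕ × ℕ → ℝ} {a : ℝ} (hf : HasSum f a) : HasSum (fun p : ℕ × ℕ => f p.swap) a :=
  (Equiv.prodComm ℕ ℕ).hasSum_iff.2 hf

lemma hs_bound {f : ℕ × ℕ → ℂ} {a : ℂ} (hf : HasSum f a) {A B : ℕ × ℕ → ℝ} {x y : ℝ}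
    (hA : HasSum A x) (hB : HasSum B y) (h : ∀ p, ‖f p‖ ≤ A p + B p) : ‖a‖ ≤ x + y := by
  have h1 := tsum_of_norm_bounded (hA.add hB) h
  rwa [hf.tsum_eq] at h1

/-- Terms of the double series. -/
def Fpq (t : ℝ) (p : ℕ × ℕ) : ℂ :=
  ((I * t) ^ p.1 / (p.1.factorial : ℂ)) * ((I * t) ^ p.2 / (p.2.factorial : ℂ))

lemma norm_Fpq (t : ℝ) (ht : 0 < t) (p : ℕ × ℕ) :
    ‖Fpq t p‖ = (t ^ p.1 / (p.1.factorial : ℝ)) * (t ^ p.2 / (p.2.factorial : ℝ)) := by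
  simp [Fpq, abs_of_pos ht]

lemma real_exp_hasSum (x : ℝ) : HasSum (fun n : ℕ => x ^ n / (n.factorial : ℝ)) (Real.exp x) := by
  rw [Real.exp_eq_exp_ℝ]
  exact NormedSpace.expSeries_div_hasSum_exp x

lemma complex_exp_hasSum (x : ℂ) : HasSum (fun n : ℕ => x ^ n / (n.factorial : ℂ)) (exp x) := by
  rw [Complex.exp_eq_exp_ℂ]
  exact NormedSpace.expSeries_div_hasSum_exp x

lemma real_mul_hasSum (x y : ℝ) (hx : 0 ≤ x) (hy : 0 ≤ y) :
    HasSum (fun p : ℕ × ℕ => (x ^ p.1 / (p.1.factorial : ℝ)) * (y ^ p.2 / (p.2.factorial : ℝ)))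
      (Real.exp x * Real.exp y) := by
  refine (real_exp_hasSum x).mul (real_exp_hasSum y) ?_
  exact (real_exp_hasSum x).summable.mul_of_nonneg (real_exp_hasSum y).summable
    (fun n => by positivity) (fun n => by positivity)

lemma summable_norm_Fpq (t : ℝ) (ht : 0 < t) : Summable (fun p => ‖Fpq t p‖) := by
  simp_rw [norm_Fpq t ht]
  exact (real_mul_hasSum t t ht.le ht.le).summable

lemma hasSum_F (t : ℝ) (z : ℂ) (hz : z ≠ 0) :
    HasSum (fun p : ℕ × ℕ => Fpq t p * z ^ ((p.1 : ℤ) - p.2)) (exp (I * t * (z + z⁻¹))) := by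
  have h1 := complex_exp_hasSum (I * t * z)
  have h2 := complex_exp_hasSum (I * t * z⁻¹)
  have h := hs_mulC h1 h2
    (NormedSpace.norm_expSeries_div_summable (𝔸 := ℂ) (I * t * z))
    (NormedSpace.norm_expSeries_div_summable (𝔸 := ℂ) (I * t * z⁻¹))
  rw [mul_add, exp_add]
  refine hs_congrC h (fun p => ?_) rfl
  rw [Fpq, zpow_sub₀ hz, mul_pow, mul_pow _ z⁻¹]
  simp only [zpow_natCast, inv_pow]
  ring

lemma integral_zpow_aux (m : ℤ) :
    ∫ θ in (0:ℝ)..(2 * Real.pi), (exp (θ * I)) ^ m = if m = 0 then ((2 * Real.pi : ℝ) : ℂ) else 0 := by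
  split_ifs with h
  · simp [h]
  · have hm : (m : ℂ) * I ≠ 0 := by simp [h]
    have e : ∀ θ : ℝ, (exp (θ * I)) ^ m = exp ((m * I) * θ) := by
      intro θ
      rw [← exp_int_mul]; ring_nf
    simp_rw [e]
    rw [integral_exp_mul_complex hm]
    have : exp ((m : ℂ) * I * ((2 * Real.pi : ℝ) : ℂ)) = 1 := by
      rw [exp_eq_one_iff]
      exact ⟨m, by push_cast; ring⟩
    rw [this]; simp

lemma norm_exp_zpow (θ : ℝ) (m : ℤ) : ‖(exp (θ * I)) ^ m‖ = 1 := by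
  rw [norm_zpow, norm_exp_ofReal_mul_I, one_zpow]

lemma cont_zpow (m : ℤ) : Continuous (fun θ : ℝ => (exp (θ * I)) ^ m) := by
  refine Continuous.zpow₀ (by fun_prop) m (fun a => Or.inl (exp_ne_zero _))

lemma ck_hasSum (t : ℝ) (ht : 0 < t) (k : ℤ) :
    HasSum (fun p : ℕ × ℕ => if (p.1 : ℤ) - p.2 = k then Fpq t p else 0) (ck t k) := by
  have h : HasSum (fun p : ℕ × ℕ => ∫ θ in (0:ℝ)..(2 * Real.pi),
      Fpq t p * (exp (θ * I)) ^ ((p.1 : ℤ) - p.2 - k))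
      (∫ θ in (0:ℝ)..(2 * Real.pi),
      Complex.exp (Complex.I * t * (Complex.exp (θ * Complex.I) +
        (Complex.exp (θ * Complex.I))⁻¹)) * (Complex.exp (θ * Complex.I)) ^ (-k)) := by
    refine intervalIntegral.hasSum_integral_of_dominated_convergence
      (fun p _ => ‖Fpq t p‖) ?_ ?_ ?_ ?_ ?_
    · intro p
      exact (continuous_const.mul (cont_zpow _)).aestronglyMeasurable
    · intro p
      refine Eventually.of_forall fun θ _ => ?_
      rw [norm_mul, norm_exp_zpow, mul_one]
    · exact Eventually.of_forall fun θ _ => summable_norm_Fpq t ht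
    · exact intervalIntegrable_const
    · refine Eventually.of_forall fun θ _ => ?_
      have := (hasSum_F t (exp (θ * I)) (exp_ne_zero _)).mul_right ((exp (θ * I)) ^ (-k))
      refine hs_congrC this (fun p => ?_) rfl
      rw [mul_assoc, ← zpow_add₀ (exp_ne_zero _)]
      rfl
  have h2 := h.const_smul ((2 * Real.pi)⁻¹)
  unfold ck
  refine hs_congrC h2 (fun p => ?_) rfl
  rw [intervalIntegral.integral_const_mul, integral_zpow_aux]
  simp only [sub_eq_zero]
  split_ifs
  · rw [real_smul]; push_cast
    have : (Real.pi : ℂ) ≠ 0 := by exact_mod_cast Real.pi_ne_zero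
    field_simp
  · simp

lemma Pnt_hasSum (n : ℕ) (t : ℝ) (ht : 0 < t) (z : ℂ) :
    HasSum (fun p : ℕ × ℕ => if (p.1 : ℤ) - p.2 ∈ Finset.Icc (-(n : ℤ)) (n : ℤ)
      then Fpq t p * z ^ ((p.1 : ℤ) - p.2) else 0) (Pnt n t z) := by
  have h := hasSum_sum (s := Finset.Icc (-(n : ℤ)) (n : ℤ))
    (fun k _ => (ck_hasSum t ht k).mul_right (z ^ k))
  unfold Pnt
  refine hs_congrC h (fun p => ?_) rfl
  simp only [ite_mul, zero_mul]
  rw [Finset.sum_ite_eq]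

/-- The dominating function. -/
def Adom (n : ℕ) (t r : ℝ) (p : ℕ × ℕ) : ℝ :=
  if p.2 + n ≤ p.1 then (t ^ n / (n.factorial : ℝ)) *
    ((t ^ p.2 / (p.2.factorial : ℝ)) * ((t / r) ^ (p.1 - p.2 - n) / ((p.1 - p.2 - n).factorial : ℝ)))
  else 0

lemma Adom_nonneg (n : ℕ) (t r : ℝ) (ht : 0 < t) (hr : 0 < r) (p : ℕ × ℕ) : 0 ≤ Adom n t r p := by
  unfold Adom; split_ifs <;> positivity

lemma Adom_hasSum (n : ℕ) (t r : ℝ) (ht : 0 < t) (hr : 0 < r) :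
    HasSum (Adom n t r) (deltant n t * Real.exp (t / r)) := by
  let φ : ℕ × ℕ → ℕ × ℕ := fun x => (n + x.2 + x.1, x.1)
  have hφ : Function.Injective φ := by
    rintro ⟨a, b⟩ ⟨c, d⟩ h
    simp only [φ, Prod.mk.injEq] at h ⊢
    omega
  have hz : ∀ p, p ∉ Set.range φ → Adom n t r p = 0 := by
    rintro ⟨a, b⟩ hp
    unfold Adom
    rw [if_neg]
    intro hle
    refine hp ⟨(b, a - b - n), ?_⟩
    simp only [φ, Prod.mk.injEq, and_true] at hle ⊢
    omega
  rw [← hφ.hasSum_iff hz]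
  have := (real_mul_hasSum t (t / r) ht.le (by positivity)).mul_left (t ^ n / (n.factorial : ℝ))
  refine hs_congrR this (fun x => ?_) ?_
  ·
    have e : n + x.2 + x.1 - x.1 - n = x.2 := by omega
    simp only [Function.comp, φ, Adom, e]
    rw [if_pos (by omega)]
  · unfold deltant; ring

lemma fact_bound (n j q : ℕ) (t : ℝ) (ht : 0 < t) (hnt : t < n) :
    t ^ (q + n + j) / ((q + n + j).factorial : ℝ) ≤
      (t ^ n / (n.factorial : ℝ)) * (t ^ j / (j.factorial : ℝ)) := by
  have h1 : ((n.factorial * j.factorial : ℕ) : ℝ) * t ^ q ≤ ((q + n + j).factorial : ℝ) := by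
    have a : n.factorial * j.factorial ≤ (n + j).factorial := Nat.le_of_dvd (Nat.factorial_pos _) (Nat.factorial_mul_factorial_dvd_factorial_add n j)
    have b : (n + j).factorial * (n + j) ^ q ≤ (n + j + q).factorial :=
      le_trans (Nat.mul_le_mul_left _ (Nat.pow_le_pow_left (Nat.le_succ _) q))
        Nat.factorial_mul_pow_le_factorial
    have c : t ^ q ≤ ((n + j : ℕ) : ℝ) ^ q := by
      apply pow_le_pow_left₀ ht.le
      push_cast; linarith [(Nat.cast_nonneg j : (0:ℝ) ≤ j)]
    have e : q + n + j = n + j + q := by omega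
    rw [e]
    calc ((n.factorial * j.factorial : ℕ) : ℝ) * t ^ q
        ≤ ((n + j).factorial : ℝ) * ((n + j : ℕ) : ℝ) ^ q := by
          gcongr
      _ ≤ _ := by exact_mod_cast b
  rw [div_mul_div_comm, div_le_div_iff₀ (by positivity) (by positivity)]
  push_cast at h1
  calc t ^ (q + n + j) * ((n.factorial : ℝ) * j.factorial)
      = (t ^ n * t ^ j) * ((n.factorial : ℝ) * j.factorial * t ^ q) := by ring
    _ ≤ _ := by gcongr

lemma term_aux (n : ℕ) (t : ℝ) (ht : 0 < t) (hnt : t < n) (r : ℝ) (hr0 : 0 < r) (a b : ℕ)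
    (h : b + n ≤ a) (w : ℝ) (hw0 : 0 ≤ w) (hw : w ≤ (r ^ (a - b - n))⁻¹) :
    (t ^ a / (a.factorial : ℝ)) * (t ^ b / (b.factorial : ℝ)) * w ≤ Adom n t r (a, b) := by
  obtain ⟨j, rfl⟩ := Nat.exists_eq_add_of_le h
  have e : b + n + j - b - n = j := by omega
  simp only [Adom, e] at hw ⊢
  rw [if_pos (by omega)]
  calc _ ≤ ((t ^ n / (n.factorial : ℝ)) * (t ^ j / (j.factorial : ℝ))) *
        (t ^ b / (b.factorial : ℝ)) * (r ^ j)⁻¹ := by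
        have := fact_bound n j b t ht hnt
        gcongr
    _ = _ := by rw [div_pow]; ring

lemma term_bound (n : ℕ) (t : ℝ) (ht : 0 < t) (hnt : t < n) (r : ℝ) (hr0 : 0 < r) (hr1 : r < 1)
    (z : ℂ) (hz : ‖z‖ = r) (p : ℕ × ℕ) :
    ‖z ^ n * (Fpq t p * z ^ ((p.1 : ℤ) - p.2) -
      if (p.1 : ℤ) - p.2 ∈ Finset.Icc (-(n : ℤ)) (n : ℤ)
      then Fpq t p * z ^ ((p.1 : ℤ) - p.2) else 0)‖ ≤ Adom n t r p + Adom n t r p.swap := by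
  have hA := Adom_nonneg n t r ht hr0 p
  have hB := Adom_nonneg n t r ht hr0 p.swap
  split_ifs with h
  · simp; linarith
  · rw [sub_zero, norm_mul, norm_mul, norm_pow, norm_zpow, hz, norm_Fpq t ht]
    obtain ⟨a, b⟩ := p
    simp only [Finset.mem_Icc, not_and_or, not_le] at h
    simp only [Prod.swap_prod_mk] at *
    rcases h with h | h
    · have hle : a + n ≤ b := by omega
      have := term_aux n t ht hnt r hr0 b a hle (r ^ n * r ^ ((a : ℤ) - b)) (by positivity) (by
        apply le_of_eq
        rw [← zpow_natCast, ← zpow_natCast, ← zpow_neg, ← zpow_add₀ hr0.ne']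
        congr 1
        omega)
      linarith
    · have hle : b + n ≤ a := by omega
      have := term_aux n t ht hnt r hr0 a b hle (r ^ n * r ^ ((a : ℤ) - b)) (by positivity) (by
        have h1 : r ^ n ≤ 1 := pow_le_one₀ hr0.le hr1.le
        have e : (a : ℤ) - b = ((a - b : ℕ) : ℤ) := by omega
        have h2 : r ^ ((a : ℤ) - b) ≤ 1 := by
          rw [e, zpow_natCast]; exact pow_le_one₀ hr0.le hr1.le
        have h3 : 1 ≤ (r ^ (a - b - n))⁻¹ :=
          (one_le_inv₀ (by positivity)).2 (pow_le_one₀ hr0.le hr1.le)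
        have h4 : 0 ≤ r ^ ((a : ℤ) - b) := by positivity
        nlinarith [pow_pos hr0 n])
      linarith

lemma tail_bound (n : ℕ) (t : ℝ) (ht : 0 < t) (hnt : t < n) (r : ℝ) (hr0 : 0 < r) (hr1 : r < 1)
    (z : ℂ) (hz : ‖z‖ = r) :
    ‖z ^ n * (exp (I * t * (z + z⁻¹)) - Pnt n t z)‖ ≤ 2 * deltant n t * Real.exp (t / r) := by
  have hz0 : z ≠ 0 := by rw [← norm_pos_iff, hz]; exact hr0
  have h := hs_subC (hasSum_F t z hz0) (Pnt_hasSum n t ht z) (z ^ n)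
  have hA := Adom_hasSum n t r ht hr0
  have hB : HasSum (fun p : ℕ × ℕ => Adom n t r p.swap) (deltant n t * Real.exp (t / r)) :=
    hs_swap hA
  have := hs_bound h hA hB (term_bound n t ht hnt r hr0 hr1 z hz)
  linarith

lemma exp_bound (t : ℝ) (ht : 0 < t) (r : ℝ) (hr0 : 0 < r) (hr1 : r < 1)
    (z : ℂ) (hz : ‖z‖ = r) : ‖exp (I * t * (z + z⁻¹))‖ ≤ Real.exp (t / r) := by
  rw [norm_exp, Real.exp_le_exp]
  have e : (I * t * (z + z⁻¹)).re = -t * (z.im + z⁻¹.im) := by simp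
  rw [e, inv_im, normSq_eq_norm_sq, hz]
  have h1 : z.im ≤ r := hz ▸ (le_trans (le_abs_self _) (abs_im_le_norm z))
  have h2 : 0 ≤ (r ^ 2)⁻¹ - 1 := by
    have := (one_le_inv₀ (a := r ^ 2) (by positivity)).2 (pow_le_one₀ hr0.le hr1.le)
    linarith
  have h3 : z.im * ((r ^ 2)⁻¹ - 1) ≤ r * ((r ^ 2)⁻¹ - 1) := by gcongr
  have h4 : r * (r ^ 2)⁻¹ = 1 / r := by field_simp
  calc -t * (z.im + -z.im / r ^ 2) = t * (z.im * ((r ^ 2)⁻¹ - 1)) := by ring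
    _ ≤ t * (1 / r) := by
      apply mul_le_mul_of_nonneg_left _ ht.le
      nlinarith
    _ = t / r := by ring

lemma zP_bound (n : ℕ) (t : ℝ) (ht : 0 < t) (hnt : t < n) (r : ℝ) (hr0 : 0 < r) (hr1 : r < 1)
    (z : ℂ) (hz : ‖z‖ = r) :
    ‖z ^ n * Pnt n t z‖ ≤ Real.exp (t / r) * (r ^ n + 2 * deltant n t) := by
  have h1 := tail_bound n t ht hnt r hr0 hr1 z hz
  have h2 := exp_bound t ht r hr0 hr1 z hz
  have e : z ^ n * Pnt n t z = z ^ n * exp (I * t * (z + z⁻¹)) -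
    z ^ n * (exp (I * t * (z + z⁻¹)) - Pnt n t z) := by ring
  rw [e]
  refine (norm_sub_le _ _).trans ?_
  have h3 : ‖z ^ n * exp (I * t * (z + z⁻¹))‖ ≤ r ^ n * Real.exp (t / r) := by
    rw [norm_mul, norm_pow, hz]; gcongr
  linarith

theorem stmt5 (n : ℕ) (t : ℝ) (ht : 0 < t) (hnt : t < (n : ℝ))
    (hδ : deltant n t < 1) (r : ℝ) (hr0 : 0 < r) (hr1 : r < 1) :
    (∀ z : ℂ, ‖z‖ = r → ‖Gnt n t z‖ ≤ Real.exp (t / r) * (r ^ n + 3 * deltant n t)) ∧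
    (∀ z : ℂ, ‖z‖ = r →
      ‖Gnt (n + 1) t z - z * Gnt n t z‖ ≤ 6 * deltant n t * Real.exp (t / r)) := by
  have hd0 : 0 < deltant n t := by unfold deltant; positivity
  have hE : 0 < Real.exp (t / r) := Real.exp_pos _
  refine ⟨fun z hz => ?_, fun z hz => ?_⟩
  · have h := zP_bound n t ht hnt r hr0 hr1 z hz
    unfold Gnt
    rw [mul_assoc, norm_mul, norm_real, Real.norm_of_nonneg (by linarith)]
    nlinarith [norm_nonneg (z ^ n * Pnt n t z), mul_pos hE hd0]
  · have hd1 : 0 < deltant (n + 1) t := by unfold deltant; positivity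
    have hdle : deltant (n + 1) t ≤ deltant n t := by
      have e : deltant (n + 1) t = deltant n t * (t / (n + 1)) := by
        unfold deltant
        rw [Nat.factorial_succ]; push_cast
        field_simp
        ring
      rw [e]
      have : t / ((n : ℝ) + 1) ≤ 1 := by rw [div_le_one (by positivity)]; linarith
      nlinarith
    have hP := zP_bound n t ht hnt r hr0 hr1 z hz
    have hT := tail_bound n t ht hnt r hr0 hr1 z hz
    have hT1 := tail_bound (n + 1) t ht (by push_cast; linarith) r hr0 hr1 z hz
    set E := exp (I * t * (z + z⁻¹)) with hEdef
    have e : Gnt (n + 1) t z - z * Gnt n t z =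
        ((1 - deltant (n + 1) t : ℝ) : ℂ) * (z * (z ^ n * (E - Pnt n t z))
          - z ^ (n + 1) * (E - Pnt (n + 1) t z))
        + ((deltant n t - deltant (n + 1) t : ℝ) : ℂ) * (z * (z ^ n * Pnt n t z)) := by
      unfold Gnt; push_cast; ring
    have hrn : r ^ n ≤ 1 := pow_le_one₀ hr0.le hr1.le
    have hP' : ‖z ^ n * Pnt n t z‖ ≤ 3 * Real.exp (t / r) := by nlinarith
    have b1 : ‖z * (z ^ n * Pnt n t z)‖ ≤ 3 * Real.exp (t / r) := by
      rw [norm_mul, hz]; nlinarith [norm_nonneg (z ^ n * Pnt n t z)]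
    have b2 : ‖z * (z ^ n * (E - Pnt n t z))‖ ≤ 2 * deltant n t * Real.exp (t / r) := by
      rw [norm_mul, hz]; nlinarith [norm_nonneg (z ^ n * (E - Pnt n t z))]
    have b3 := (norm_sub_le (z * (z ^ n * (E - Pnt n t z)))
      (z ^ (n + 1) * (E - Pnt (n + 1) t z))).trans (add_le_add b2 hT1)
    rw [e]
    refine (norm_add_le _ _).trans ?_
    rw [norm_mul, norm_mul (((deltant n t - deltant (n + 1) t : ℝ) : ℂ)), norm_real, norm_real,
      Real.norm_of_nonneg (by linarith), Real.norm_of_nonneg (by linarith)]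
    have c1 := mul_le_mul_of_nonneg_left b1 (sub_nonneg.2 hdle)
    have c2 := mul_le_of_le_one_left (norm_nonneg (z * (z ^ n * (E - Pnt n t z)) -
      z ^ (n + 1) * (E - Pnt (n + 1) t z))) (by linarith : 1 - deltant (n + 1) t ≤ 1)
    have c3 := mul_pos hE hd0
    have c4 := mul_pos hE hd1
    nlinarith
end
end
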